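/- Let D be a positive definite diagonal matrix, A symmetric nonnegative with D - A a connected graph Laplacian, and r an odd positive integer. Then for any vertices u₀ and u_r joined by a walk (u₀, u₁, …, u_r) in G (each A(u_{i-1},u_i) > 0), the effective resistance between u₀ and u_r in the graph G_r with Laplacian L_{G_r} = D - D(D⁻¹A)^r satisfies R_{G_r}(u₀, u_r) ≤ Σ_{i=1}^r 2/A(u_{i-1}, u_i). -/

import Mathlib

open Matrix

/-- `P` satisfies the four Moore–Penrose conditions for `L`. -/
def IsMoorePenrose {V : Type*} [Fintype V] [DecidableEq V]
    (L P : Matrix V V ℝ) : Prop :=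
  L * P * L = L ∧ P * L * P = P ∧ (L * P)ᵀ = L * P ∧ (P * L)ᵀ = P * L

namespace Matrix

variable {V : Type*} [Fintype V]

/-- The quadratic form of a Laplacian `D - A` as a sum over ordered pairs. -/
lemma dotProduct_laplacian_mulVec {D A : Matrix V V ℝ} (hDdiag : D.IsDiag) (hA : A.IsSymm)
    (hrow : (D - A) *ᵥ (fun _ => (1 : ℝ)) = 0) (x : V → ℝ) :
    x ⬝ᵥ ((D - A) *ᵥ x) = (1 / 2) * ∑ u, ∑ v, A u v * (x u - x v) ^ 2 := by
  classical
  have hdeg : ∀ u, D u u = ∑ v, A u v := by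
    intro u
    have h := congrFun hrow u
    simp only [mulVec, dotProduct, sub_apply, mul_one, Finset.sum_sub_distrib,
      Pi.zero_apply] at h
    rw [Finset.sum_eq_single u (fun v _ hv => hDdiag hv.symm) (by simp)] at h
    linarith
  have hD : ∀ u, ∑ v, D u v * x v = ∑ v, A u v * x u := by
    intro u
    rw [Finset.sum_eq_single u (fun v _ hv => by rw [hDdiag hv.symm, zero_mul]) (by simp),
      hdeg, Finset.sum_mul]
  have hform : x ⬝ᵥ ((D - A) *ᵥ x) = ∑ u, ∑ v, A u v * (x u * (x u - x v)) := by
    simp only [mulVec, dotProduct, sub_apply, sub_mul, Finset.sum_sub_distrib, hD]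
    simp only [← Finset.sum_sub_distrib, Finset.mul_sum]
    exact Finset.sum_congr rfl fun u _ => Finset.sum_congr rfl fun v _ => by ring
  have hswap : ∑ u, ∑ v, A u v * (x u * (x u - x v))
      = ∑ u, ∑ v, A u v * (x v * (x v - x u)) := by
    rw [Finset.sum_comm]
    exact Finset.sum_congr rfl fun u _ => Finset.sum_congr rfl fun v _ => by rw [hA.apply]
  have hsum : ∑ u, ∑ v, A u v * (x u - x v) ^ 2
      = ∑ u, ∑ v, A u v * (x u * (x u - x v)) + ∑ u, ∑ v, A u v * (x v * (x v - x u)) := by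
    simp only [← Finset.sum_add_distrib]
    exact Finset.sum_congr rfl fun u _ => Finset.sum_congr rfl fun v _ => by ring
  rw [hsum, ← hswap, hform]
  ring

lemma posSemidef_laplacian {D A : Matrix V V ℝ} (hDdiag : D.IsDiag) (hA : A.IsSymm)
    (hA0 : ∀ u v, 0 ≤ A u v) (hrow : (D - A) *ᵥ (fun _ => (1 : ℝ)) = 0) :
    (D - A).PosSemidef := by
  refine PosSemidef.of_dotProduct_mulVec_nonneg ?_ fun x => ?_
  · rw [IsHermitian, conjTranspose_eq_transpose_of_trivial]
    exact hDdiag.isSymm.sub hA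
  · rw [star_trivial, dotProduct_laplacian_mulVec hDdiag hA hrow]
    exact mul_nonneg (by norm_num) (Finset.sum_nonneg fun u _ => Finset.sum_nonneg fun v _ =>
      mul_nonneg (hA0 u v) (sq_nonneg _))

lemma mul_pow_eq_transpose_pow_mul [DecidableEq V] {D M : Matrix V V ℝ} (h : D * M = Mᵀ * D)
    (k : ℕ) : D * M ^ k = (M ^ k)ᵀ * D := by
  rw [transpose_pow]
  exact (SemiconjBy.pow_right h k : SemiconjBy D (M ^ k) (Mᵀ ^ k))

/-- If `N` commutes with `M` and is self-adjoint for the form `D`, then `D * (1 - M) ⪰ 0` implies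
`D * (N ^ 2 * (1 - M)) ⪰ 0`. -/
lemma PosSemidef.mul_sq_mul_one_sub [DecidableEq V] {D M N : Matrix V V ℝ}
    (hL : (D * (1 - M)).PosSemidef) (hN : D * N = Nᵀ * D) (hNM : Commute N M) :
    (D * (N * N * (1 - M))).PosSemidef := by
  have h := hL.conjTranspose_mul_mul_same N
  have hc : (1 - M) * N = N * (1 - M) := ((Commute.one_right N).sub_right hNM).eq.symm
  have he : D * (N * N * (1 - M)) = Nᴴ * (D * (1 - M)) * N := by
    rw [conjTranspose_eq_transpose_of_trivial, ← Matrix.mul_assoc Nᵀ, ← hN]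
    simp only [Matrix.mul_assoc, hc]
  rwa [he]

open Polynomial in
/-- The matrix form of `0 ≤ (1 - t ^ (2 * k)) * (1 + t)` for `t ≤ 1`. -/
lemma PosSemidef.mul_one_sub_pow_mul_one_add [DecidableEq V] {D M : Matrix V V ℝ}
    (hL : (D * (1 - M)).PosSemidef) (hDM : D * M = Mᵀ * D) (k : ℕ) :
    (D * ((1 - M ^ (2 * k)) * (1 + M))).PosSemidef := by
  induction k with
  | zero => simpa using PosSemidef.zero
  | succ k ih =>
    have hN : D * (M ^ k + M ^ (k + 1)) = (M ^ k + M ^ (k + 1))ᵀ * D := by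
      rw [Matrix.mul_add, transpose_add, Matrix.add_mul, mul_pow_eq_transpose_pow_mul hDM,
        mul_pow_eq_transpose_pow_mul hDM]
    have hNM : Commute (M ^ k + M ^ (k + 1)) M :=
      ((Commute.refl M).pow_left k).add_left ((Commute.refl M).pow_left (k + 1))
    have he : D * ((1 - M ^ (2 * (k + 1))) * (1 + M)) = D * ((1 - M ^ (2 * k)) * (1 + M)) +
        D * ((M ^ k + M ^ (k + 1)) * (M ^ k + M ^ (k + 1)) * (1 - M)) := by
      rw [← Matrix.mul_add]
      have h := congrArg (Polynomial.aeval M) (show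
        ((1 - X ^ (2 * (k + 1))) * (1 + X) : ℝ[X]) = (1 - X ^ (2 * k)) * (1 + X) +
          (X ^ k + X ^ (k + 1)) * (X ^ k + X ^ (k + 1)) * (1 - X) by ring)
      simp only [map_add, map_sub, map_mul, map_pow, map_one, aeval_X] at h
      rw [h]
    rw [he]
    exact ih.add (hL.mul_sq_mul_one_sub hN hNM)

open Polynomial in
/-- The matrix form of `(1 - t) / 2 ≤ 1 - t ^ r` for `t ≤ 1` and odd `r`. -/
lemma PosSemidef.sub_mul_odd_pow [DecidableEq V] {D M : Matrix V V ℝ}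
    (hL : (D * (1 - M)).PosSemidef) (hDM : D * M = Mᵀ * D) {r : ℕ} (hr : Odd r) :
    ((2 : ℝ) • (D - D * M ^ r) - D * (1 - M)).PosSemidef := by
  obtain ⟨k, rfl⟩ := hr
  have he : (2 : ℝ) • (D - D * M ^ (2 * k + 1)) - D * (1 - M) =
      D * ((1 - M ^ (2 * k)) * (1 + M)) + D * (M ^ k * M ^ k * (1 - M)) := by
    have h := congrArg (Polynomial.aeval M) (show
      ((1 - X ^ (2 * k + 1)) + (1 - X ^ (2 * k + 1)) - (1 - X) : ℝ[X]) =
        (1 - X ^ (2 * k)) * (1 + X) + X ^ k * X ^ k * (1 - X) by ring)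
    simp only [map_add, map_sub, map_mul, map_pow, map_one, aeval_X] at h
    rw [← Matrix.mul_add, ← h]
    simp only [two_smul, Matrix.mul_sub, Matrix.mul_add, Matrix.mul_one]
  rw [he]
  exact (hL.mul_one_sub_pow_mul_one_add hDM k).add
    (hL.mul_sq_mul_one_sub (mul_pow_eq_transpose_pow_mul hDM k) ((Commute.refl M).pow_left k))

end Matrix

/-- A finite set of descending pairs containing every descending step of a real sequence has total
length at least the drop of the sequence. -/
lemma sub_le_sum_of_steps_mem {V : Type*} (x : V → ℝ) (T : Finset (V × V))
    (hT : ∀ p ∈ T, x p.2 ≤ x p.1) {r : ℕ} (u : Fin (r + 1) → V)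
    (hu : ∀ i : Fin r, x (u i.succ) < x (u i.castSucc) → (u i.castSucc, u i.succ) ∈ T) :
    x (u 0) - x (u (Fin.last r)) ≤ ∑ p ∈ T, (x p.1 - x p.2) := by
  have hcover : Set.Ioc (x (u (Fin.last r))) (x (u 0)) ⊆
      ⋃ p ∈ T, Set.Ioc (x p.2) (x p.1) := by
    rintro t ⟨ht, ht0⟩
    by_contra hn
    have hle : ∀ i : Fin (r + 1), t ≤ x (u i) := by
      intro i
      induction i using Fin.induction with
      | zero => exact ht0
      | succ i ih =>
        by_contra! hlt
        exact hn (Set.mem_biUnion (hu i (hlt.trans_le ih)) ⟨hlt, ih⟩)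
    exact ht.not_ge (hle _)
  have h := (MeasureTheory.measure_mono (μ := MeasureTheory.volume) hcover).trans
    (MeasureTheory.measure_biUnion_finset_le _ _)
  simp only [Real.volume_Ioc] at h
  rw [← ENNReal.ofReal_sum_of_nonneg fun p hp => sub_nonneg.2 (hT p hp)] at h
  exact (ENNReal.ofReal_le_ofReal_iff
    (Finset.sum_nonneg fun p hp => sub_nonneg.2 (hT p hp))).1 h

/-- The squared potential drop along a walk is at most the energy times the sum of the edge
resistances. -/
lemma sq_sub_le_energy_mul_sum_inv {V : Type*} [Fintype V] {A : Matrix V V ℝ} (hA : A.IsSymm)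
    (hA0 : ∀ u v, 0 ≤ A u v) (x : V → ℝ) {r : ℕ} (u : Fin (r + 1) → V)
    (hwalk : ∀ i : Fin r, 0 < A (u i.castSucc) (u i.succ))
    (hx : x (u (Fin.last r)) ≤ x (u 0)) :
    (x (u 0) - x (u (Fin.last r))) ^ 2 ≤
      (∑ i : Fin r, (A (u i.castSucc) (u i.succ))⁻¹) *
        ((1 / 2) * ∑ u, ∑ v, A u v * (x u - x v) ^ 2) := by
  classical
  let S : Finset (V × V) := Finset.univ.image fun i : Fin r => (u i.castSucc, u i.succ)
  let T : Finset (V × V) := S.filter fun p => x p.2 < x p.1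
  have hpos : ∀ p ∈ T, 0 < A p.1 p.2 := by
    intro p hp
    obtain ⟨i, -, rfl⟩ := Finset.mem_image.1 (Finset.mem_filter.1 hp).1
    exact hwalk i
  have hdrop : x (u 0) - x (u (Fin.last r)) ≤ ∑ p ∈ T, (x p.1 - x p.2) :=
    sub_le_sum_of_steps_mem x T (fun p hp => (Finset.mem_filter.1 hp).2.le) u fun i hi =>
      Finset.mem_filter.2 ⟨Finset.mem_image_of_mem _ (Finset.mem_univ i), hi⟩
  have hinv : ∑ p ∈ T, (A p.1 p.2)⁻¹ ≤ ∑ i : Fin r, (A (u i.castSucc) (u i.succ))⁻¹ :=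
    (Finset.sum_le_sum_of_subset_of_nonneg (Finset.filter_subset _ S)
      fun p _ _ => inv_nonneg.2 (hA0 _ _)).trans
      (Finset.sum_image_le_of_nonneg fun p _ => inv_nonneg.2 (hA0 _ _))
  have henergy : ∑ p ∈ T, A p.1 p.2 * (x p.1 - x p.2) ^ 2 ≤
      (1 / 2) * ∑ u, ∑ v, A u v * (x u - x v) ^ 2 := by
    let f : V → V → ℝ := fun u v => if x v < x u then A u v * (x u - x v) ^ 2 else 0
    have hf : ∀ u v, 0 ≤ f u v := fun u v => by
      by_cases h : x v < x u
      · simpa only [f, if_pos h] using mul_nonneg (hA0 u v) (sq_nonneg _)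
      · simp only [f, if_neg h, le_refl]
    have hTf : ∑ p ∈ T, A p.1 p.2 * (x p.1 - x p.2) ^ 2 ≤ ∑ u, ∑ v, f u v := by
      rw [← Fintype.sum_prod_type' f]
      rw [Finset.sum_congr rfl fun p hp => (if_pos (Finset.mem_filter.1 hp).2).symm]
      exact Finset.sum_le_sum_of_subset_of_nonneg (Finset.subset_univ T) fun p _ _ => hf _ _
    have hff : ∑ u, ∑ v, f u v + ∑ u, ∑ v, f u v ≤ ∑ u, ∑ v, A u v * (x u - x v) ^ 2 := by
      nth_rewrite 2 [Finset.sum_comm]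
      simp only [← Finset.sum_add_distrib]
      refine Finset.sum_le_sum fun u _ => Finset.sum_le_sum fun v _ => ?_
      have hnn := mul_nonneg (hA0 u v) (sq_nonneg (x u - x v))
      have hsw : A v u * (x v - x u) ^ 2 = A u v * (x u - x v) ^ 2 := by
        rw [hA.apply]
        ring
      rcases lt_trichotomy (x u) (x v) with h | h | h
      · simp [f, h, h.not_gt, hsw]
      · simp [f, h]
      · simp [f, h, h.not_gt]
    linarith
  calc (x (u 0) - x (u (Fin.last r))) ^ 2 ≤ (∑ p ∈ T, (x p.1 - x p.2)) ^ 2 :=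
        pow_le_pow_left₀ (sub_nonneg.2 hx) hdrop 2
    _ ≤ (∑ p ∈ T, (A p.1 p.2)⁻¹) * ∑ p ∈ T, A p.1 p.2 * (x p.1 - x p.2) ^ 2 :=
        Finset.sum_sq_le_sum_mul_sum_of_sq_le_mul T (fun p _ => inv_nonneg.2 (hA0 _ _))
          (fun p _ => mul_nonneg (hA0 _ _) (sq_nonneg _))
          fun p hp => (inv_mul_cancel_left₀ (hpos p hp).ne' _).ge
    _ ≤ _ := mul_le_mul hinv henergy
        (Finset.sum_nonneg fun p _ => mul_nonneg (hA0 _ _) (sq_nonneg _))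
        (Finset.sum_nonneg fun i _ => inv_nonneg.2 (hA0 _ _))

/-- If a symmetric matrix kills exactly the constant vectors, a Moore–Penrose inverse solves
`K *ᵥ y = b` for every `b` orthogonal to the constants. -/
lemma IsMoorePenrose.mulVec_mulVec_eq {V : Type*} [Fintype V] [DecidableEq V]
    {K P : Matrix V V ℝ} (hP : IsMoorePenrose K P) (hK : K.IsSymm)
    (hK1 : K *ᵥ (fun _ => (1 : ℝ)) = 0)
    (hker : ∀ z : V → ℝ, K *ᵥ z = 0 → ∃ c : ℝ, z = fun _ => c)
    {b : V → ℝ} (hb : (fun _ => (1 : ℝ)) ⬝ᵥ b = 0) : K *ᵥ (P *ᵥ b) = b := by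
  obtain ⟨hKPK, -, hKP, -⟩ := hP
  have hKKP : K * (K * P) = K := by
    have h := congrArg transpose hKPK
    rwa [transpose_mul, hKP, hK.eq] at h
  have hz : K *ᵥ (b - K *ᵥ (P *ᵥ b)) = 0 := by
    rw [mulVec_sub, mulVec_mulVec, mulVec_mulVec, Matrix.mul_assoc, hKKP, sub_self]
  obtain ⟨c, hc⟩ := hker _ hz
  have hone : (fun _ => (1 : ℝ)) ⬝ᵥ (b - K *ᵥ (P *ᵥ b)) = 0 := by
    rw [dotProduct_sub, hb, dotProduct_mulVec, ← mulVec_transpose, hK.eq, hK1, zero_dotProduct,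
      sub_zero]
  have hself : (b - K *ᵥ (P *ᵥ b)) ⬝ᵥ (b - K *ᵥ (P *ᵥ b)) = 0 := by
    nth_rewrite 1 [hc]
    rw [show (fun _ : V => c) = c • (fun _ => (1 : ℝ)) by ext; simp, smul_dotProduct, hone,
      smul_zero]
  exact (sub_eq_zero.1 (dotProduct_self_eq_zero.1 hself)).symm

theorem stmt_17 (V : Type*) [Fintype V] [DecidableEq V]
    (D A : Matrix V V ℝ) (hD : D.PosDef) (hDdiag : D.IsDiag)
    (hA : A.IsSymm) (hA0 : ∀ u v, 0 ≤ A u v)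
    (hrow : (D - A) *ᵥ (fun _ => (1 : ℝ)) = 0)
    (hconn : ∀ x : V → ℝ, (D - A) *ᵥ x = 0 → ∃ c : ℝ, x = fun _ => c)
    (r : ℕ) (hr : 0 < r) (hodd : Odd r)
    (P : Matrix V V ℝ) (hP : IsMoorePenrose (D - D * (D⁻¹ * A) ^ r) P)
    (u : Fin (r + 1) → V) (hwalk : ∀ i : Fin r, 0 < A (u i.castSucc) (u i.succ)) :
    ((Pi.single (u 0) 1 : V → ℝ) - (Pi.single (u (Fin.last r)) 1 : V → ℝ)) ⬝ᵥ
        (P *ᵥ ((Pi.single (u 0) 1 : V → ℝ) - (Pi.single (u (Fin.last r)) 1 : V → ℝ))) ≤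
      ∑ i : Fin r, 2 / A (u i.castSucc) (u i.succ) := by
  have hdet : IsUnit D.det := (isUnit_iff_isUnit_det D).1 hD.isUnit
  have hDM : D * (D⁻¹ * A) = A := mul_nonsing_inv_cancel_left D A hdet
  have hself : D * (D⁻¹ * A) = (D⁻¹ * A)ᵀ * D := by
    rw [hDM, transpose_mul, hA.eq, transpose_nonsing_inv, hDdiag.isSymm.eq,
      nonsing_inv_mul_cancel_right D A hdet]
  have hLeq : D * (1 - D⁻¹ * A) = D - A := by rw [Matrix.mul_sub, hDM, Matrix.mul_one]
  have hL := posSemidef_laplacian hDdiag hA hA0 hrow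
  have hM1 : (D⁻¹ * A) *ᵥ (fun _ => (1 : ℝ)) = fun _ => 1 := by
    rw [sub_mulVec, sub_eq_zero] at hrow
    rw [← mulVec_mulVec, ← hrow, mulVec_mulVec, nonsing_inv_mul D hdet, one_mulVec]
  have hMpow : ∀ k : ℕ, (D⁻¹ * A) ^ k *ᵥ (fun _ => (1 : ℝ)) = fun _ => 1 := by
    intro k
    induction k with
    | zero => rw [pow_zero, one_mulVec]
    | succ k ih => rw [pow_succ, ← mulVec_mulVec, hM1, ih]
  have hspec := PosSemidef.sub_mul_odd_pow (hLeq.symm ▸ hL) hself hodd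
  rw [hLeq] at hspec
  have hKsymm : (D - D * (D⁻¹ * A) ^ r).IsSymm := by
    rw [IsSymm, transpose_sub, transpose_mul, hDdiag.isSymm.eq,
      ← mul_pow_eq_transpose_pow_mul hself]
  have hK1 : (D - D * (D⁻¹ * A) ^ r) *ᵥ (fun _ => (1 : ℝ)) = 0 := by
    rw [sub_mulVec, ← mulVec_mulVec, hMpow, sub_self]
  generalize D - D * (D⁻¹ * A) ^ r = K at hP hspec hKsymm hK1
  have hquad : ∀ x : V → ℝ, x ⬝ᵥ ((D - A) *ᵥ x) ≤ 2 * (x ⬝ᵥ (K *ᵥ x)) := by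
    intro x
    have h := hspec.dotProduct_mulVec_nonneg x
    rw [star_trivial, sub_mulVec, smul_mulVec, dotProduct_sub, dotProduct_smul, smul_eq_mul] at h
    linarith
  have hker : ∀ z : V → ℝ, K *ᵥ z = 0 → ∃ c : ℝ, z = fun _ => c := by
    intro z hz
    have h0 := hL.dotProduct_mulVec_nonneg z
    have h1 := hquad z
    rw [hz, dotProduct_zero, mul_zero] at h1
    exact hconn z ((hL.dotProduct_mulVec_zero_iff z).1 (le_antisymm h1 h0))
  set b : V → ℝ := Pi.single (u 0) 1 - Pi.single (u (Fin.last r)) 1 with hb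
  set x : V → ℝ := P *ᵥ b with hx
  have hKx : K *ᵥ x = b := hP.mulVec_mulVec_eq hKsymm hK1 hker (by simp [hb, dotProduct_sub])
  have hbx : b ⬝ᵥ x = x (u 0) - x (u (Fin.last r)) := by simp [hb, sub_dotProduct]
  have hq := hquad x
  rw [hKx, dotProduct_comm x b] at hq
  have hnn : 0 ≤ x ⬝ᵥ ((D - A) *ᵥ x) := hL.dotProduct_mulVec_nonneg x
  have hR : 0 ≤ b ⬝ᵥ x := by linarith
  have hCS := sq_sub_le_energy_mul_sum_inv hA hA0 x u hwalk (by linarith)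
  rw [← dotProduct_laplacian_mulVec hDdiag hA hrow, ← hbx] at hCS
  have hS : 0 ≤ ∑ i : Fin r, (A (u i.castSucc) (u i.succ))⁻¹ :=
    Finset.sum_nonneg fun i _ => inv_nonneg.2 (hA0 _ _)
  simp only [div_eq_mul_inv, ← Finset.mul_sum]
  rcases hR.eq_or_lt with h0 | hpos
  · rw [← h0]
    positivity
  · have := mul_le_mul_of_nonneg_left hq hS
    refine le_of_mul_le_mul_right ?_ hpos
    nlinarith
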